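/- Let I ⊂ ℝ be an open interval, a ∈ C^N(I, ℂ) with N ≥ 1, λ ∈ ℂ \ {0}, and x₀, x ∈ I. Let R_N(x,x₀) = a(x) − Σ_{j=0}^{N−1} (1/j!) (D^{λ,(j)}a)(x₀) (e^{λ(x−x₀)} − 1)^j. Then |R_N(x,x₀)| ≤ (|λ|/(N−1)!) · (sup over ξ in the closed segment from x₀ to x of |(D^{λ,(N)}a)(ξ)|) · (sup over real η with |η| ≤ |x−x₀| of |e^{λη} − 1|)^{N−1} · |x − x₀|. -/

import Mathlib

open Complex Filter Finset Nat

/-- The differential operators `D^{λ,(j)}` acting on functions `ℝ → ℂ`: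
`D^{λ,(0)} = Id` and `D^{λ,(j+1)} = ((1/λ)·d/dx − j·Id) ∘ D^{λ,(j)}`. -/
noncomputable def expD (lam : ℂ) : ℕ → (ℝ → ℂ) → (ℝ → ℂ)
  | 0, a => a
  | (j + 1), a => fun x =>
      (1 / lam) * deriv (expD lam j a) x - (j : ℂ) * expD lam j a x

theorem contDiffOn_expD {I : Set ℝ} (hI : IsOpen I) (lam : ℂ) {a : ℝ → ℂ} (j m : ℕ)
    (ha : ContDiffOn ℝ (m + j : ℕ) a I) : ContDiffOn ℝ m (expD lam j a) I := by
  induction j generalizing m with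
  | zero => simpa [expD] using ha
  | succ j ih =>
    have h : ContDiffOn ℝ (m + 1 : ℕ) (expD lam j a) I :=
      ih (m + 1) (by rwa [show m + 1 + j = m + (j + 1) by ring])
    have h' : ContDiffOn ℝ m (deriv (expD lam j a)) I :=
      h.deriv_of_isOpen hI (by norm_cast)
    have h0 : ContDiffOn ℝ m (expD lam j a) I := h.of_le (by norm_cast; lia)
    exact (contDiffOn_const.mul h').sub (contDiffOn_const.mul h0)

theorem hasDerivAt_expD {I : Set ℝ} (hI : IsOpen I) {lam : ℂ} (hlam : lam ≠ 0) {a : ℝ → ℂ}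
    {j : ℕ} (ha : ContDiffOn ℝ (j + 1 : ℕ) a I) {ξ : ℝ} (hξ : ξ ∈ I) :
    HasDerivAt (expD lam j a) (lam * (expD lam (j + 1) a ξ + j * expD lam j a ξ)) ξ := by
  have h : ContDiffOn ℝ (1 : ℕ) (expD lam j a) I :=
    contDiffOn_expD hI lam j 1 (by rwa [add_comm 1 j])
  have hd := ((h.contDiffAt (hI.mem_nhds hξ)).differentiableAt (by simp)).hasDerivAt
  refine hd.congr_deriv ?_
  simp only [expD]
  field_simp
  ring

theorem hasDerivAt_exp_taylor_sum {I : Set ℝ} (hI : IsOpen I) {lam : ℂ} (hlam : lam ≠ 0)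
    {a : ℝ → ℂ} (n : ℕ) (ha : ContDiffOn ℝ (n + 1 : ℕ) a I) (x : ℝ) {ξ : ℝ} (hξ : ξ ∈ I) :
    HasDerivAt (fun t : ℝ => ∑ j ∈ Finset.range (n + 1),
        (1 / (j ! : ℂ)) * expD lam j a t * (Complex.exp (lam * (x - t)) - 1) ^ j)
      (lam / (n ! : ℂ) * expD lam (n + 1) a ξ * (Complex.exp (lam * (x - ξ)) - 1) ^ n) ξ := by
  have hu : HasDerivAt (fun t : ℝ => Complex.exp (lam * (x - t)) - 1)
      (Complex.exp (lam * (x - ξ)) * (lam * -1)) ξ :=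
    (((Complex.ofRealCLM.hasDerivAt (x := ξ)).const_sub (x : ℂ)).const_mul lam).cexp.sub_const 1
  induction n with
  | zero => simpa [expD] using hasDerivAt_expD hI hlam ha hξ
  | succ n ih =>
    have hs := ih (ha.of_le (by norm_cast; lia))
    have ht := ((hasDerivAt_expD hI hlam ha hξ).const_mul (1 / ((n + 1)! : ℂ))).mul
      (hu.pow (n + 1))
    simp only [Finset.sum_range_succ _ (n + 1)]
    refine (hs.add ht).congr_deriv ?_
    have h1 : (n ! : ℂ) ≠ 0 := by exact_mod_cast Nat.factorial_ne_zero n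
    have h2 : (n : ℂ) + 1 ≠ 0 := by exact_mod_cast Nat.succ_ne_zero n
    simp only [Nat.factorial_succ, Nat.cast_mul, Nat.cast_add, Nat.cast_one,
      Nat.add_sub_cancel, Pi.pow_apply]
    field_simp
    ring

theorem le_biSup_norm_of_continuousOn {s : Set ℝ} (hs : IsCompact s) {f : ℝ → ℂ}
    (hf : ContinuousOn f s) {t : ℝ} (ht : t ∈ s) : ‖f t‖ ≤ ⨆ ξ ∈ s, ‖f ξ‖ := by
  obtain ⟨C, hC⟩ := hs.exists_bound_of_continuousOn hf
  have hb : BddAbove (Set.range fun ξ => ⨆ _ : ξ ∈ s, ‖f ξ‖) := by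
    refine ⟨C, ?_⟩
    rintro _ ⟨ξ, rfl⟩
    exact Real.iSup_le (hC ξ) ((norm_nonneg _).trans (hC t ht))
  refine le_trans ?_ (le_ciSup hb t)
  simp [ht]

theorem exp_taylor_remainder_bound
    (I : Set ℝ) (hI : IsOpen I) (hI' : I.OrdConnected)
    (N : ℕ) (hN1 : 1 ≤ N) (a : ℝ → ℂ) (ha : ContDiffOn ℝ N a I)
    (lam : ℂ) (hlam : lam ≠ 0)
    (x₀ x : ℝ) (hx₀ : x₀ ∈ I) (hx : x ∈ I)
    (R : ℂ)
    (hR : R = a x - ∑ j ∈ Finset.range N,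
        (1 / (j ! : ℂ)) * expD lam j a x₀ * (Complex.exp (lam * (x - x₀)) - 1) ^ j) :
    ‖R‖ ≤ (‖lam‖ / ((N - 1)! : ℝ))
      * (⨆ ξ ∈ Set.uIcc x₀ x, ‖expD lam N a ξ‖)
      * (⨆ η ∈ Set.Icc (-|x - x₀|) |x - x₀|, ‖Complex.exp (lam * η) - 1‖) ^ (N - 1)
      * |x - x₀| := by
  obtain ⟨n, rfl⟩ : ∃ n, N = n + 1 := ⟨N - 1, by lia⟩
  simp only [Nat.add_sub_cancel]
  have hsub : Set.uIcc x₀ x ⊆ I := hI'.uIcc_subset hx₀ hx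
  have hD : ContinuousOn (expD lam (n + 1) a) (Set.uIcc x₀ x) :=
    (contDiffOn_expD hI lam (n + 1) 0 (by simpa using ha)).continuousOn.mono hsub
  have hE : ContinuousOn (fun η : ℝ => Complex.exp (lam * η) - 1)
      (Set.Icc (-|x - x₀|) |x - x₀|) := by fun_prop
  have key := (convex_uIcc x₀ x).norm_image_sub_le_of_norm_hasDerivWithin_le
    (C := (‖lam‖ / (n ! : ℝ)) * (⨆ ξ ∈ Set.uIcc x₀ x, ‖expD lam (n + 1) a ξ‖)
      * (⨆ η ∈ Set.Icc (-|x - x₀|) |x - x₀|, ‖Complex.exp (lam * η) - 1‖) ^ n)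
    (fun ξ hξ => (hasDerivAt_exp_taylor_sum hI hlam n ha x (hsub hξ)).hasDerivWithinAt)
    ?_ Set.left_mem_uIcc Set.right_mem_uIcc
  · rw [Real.norm_eq_abs] at key
    rw [hR]
    simpa only [Finset.sum_range_succ' _ n, expD, sub_self, mul_zero, Complex.exp_zero, zero_pow,
      ne_eq, Nat.add_eq_zero_iff, one_ne_zero, and_false, not_false_eq_true, Finset.sum_const_zero,
      pow_zero, Nat.factorial_zero, Nat.cast_one, div_one, one_mul, mul_one, zero_add] using key
  · intro ξ hξ
    have hη : x - ξ ∈ Set.Icc (-|x - x₀|) |x - x₀| :=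
      abs_le.mp (by simpa [abs_sub_comm] using Set.abs_sub_right_of_mem_uIcc hξ)
    have h1 := le_biSup_norm_of_continuousOn isCompact_uIcc hD hξ
    have h2 := le_biSup_norm_of_continuousOn isCompact_Icc hE hη
    rw [Complex.ofReal_sub] at h2
    rw [norm_mul, norm_mul, norm_div, norm_pow, Complex.norm_natCast]
    have h3 := (norm_nonneg _).trans h1
    gcongr
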